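/- arXiv:1905.12851 — 3 statements merged into one kernel-verified Lean document; each statement's English description precedes it below -/
import Mathlib

section
/- For every integer k ≥ 1 and every real number t, the finite product ∏_{m=1}^{k} cos(t/2^m) equals (1/2^{k-1}) · ∑_{m=1}^{2^{k-1}} cos(((m − 1/2)/2^{k-1}) · t). -/
open Real Finset

theorem sum_range_two_mul_cos_odd_mul (N : ℕ) (y : ℝ) :
    ∑ i ∈ range (2 * N), cos ((2 * (i : ℝ) + 1) * y) =
      2 * cos y * ∑ i ∈ range N, cos ((2 * (i : ℝ) + 1) * (2 * y)) := by
  induction N with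
  | zero => simp
  | succ N ih =>
    rw [mul_add_one, sum_range_succ, sum_range_succ, ih, sum_range_succ, mul_add,
      mul_right_comm 2 (cos y) (cos _), two_mul_cos_mul_cos, add_assoc]
    congr 3 <;> push_cast <;> ring

theorem prod_cos_div_two_pow (n : ℕ) (t : ℝ) :
    ∏ m ∈ Icc 1 (n + 1), cos (t / 2 ^ m) =
      1 / 2 ^ n * ∑ i ∈ range (2 ^ n), cos ((2 * (i : ℝ) + 1) * (t / 2 ^ (n + 1))) := by
  induction n with
  | zero => simp
  | succ n ih =>
    have h : t / 2 ^ (n + 1) = 2 * (t / 2 ^ (n + 1 + 1)) := by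
      field_simp
      ring
    rw [prod_Icc_succ_top (by lia), ih, h, pow_succ' (2 : ℕ) n, sum_range_two_mul_cos_odd_mul, pow_succ' (2 : ℝ) n, one_div_mul_eq_div,
      one_div_mul_eq_div, mul_assoc 2, mul_div_mul_left _ _ two_ne_zero, mul_comm (cos _), div_mul_eq_mul_div]

theorem product_to_sum_identity (k : ℕ) (hk : 1 ≤ k) (t : ℝ) :
    ∏ m ∈ Finset.Icc 1 k, Real.cos (t / 2 ^ m) =
      (1 / 2 ^ (k - 1)) *
        ∑ m ∈ Finset.Icc (1 : ℕ) (2 ^ (k - 1)),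
          Real.cos ((((m : ℝ) - 1 / 2) / 2 ^ (k - 1)) * t) := by
  obtain ⟨n, rfl⟩ := Nat.exists_eq_add_of_le' hk
  rw [prod_cos_div_two_pow, Nat.add_sub_cancel, range_eq_Ico, ← Ico_add_one_right_eq_Icc,
    ← sum_Ico_add' _ 0 (2 ^ n) 1]
  congr 1
  refine sum_congr rfl fun i _ => congrArg cos ?_
  push_cast
  field_simp
  ring
end

section
/- For all real numbers x and y with y > 0, the Faddeeva function satisfies w(x + iy) = (1/√π) · ∫_{0}^{∞} exp(−t²/4) · exp(i(x+iy)t) dt; in particular the integral on the right converges. -/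
open Real Complex MeasureTheory intervalIntegral

/-- The Faddeeva (complex error) function
`w(z) = e^{-z²} (1 + (2i/√π) ∫₀^z e^{s²} ds)`, where the contour integral from
`0` to `z` is taken along the straight-line segment (the integrand is entire, so
the integral is path-independent). -/
noncomputable def faddeeva (z : ℂ) : ℂ :=
  Complex.exp (-z ^ 2) *
    (1 + (2 * Complex.I / (Real.sqrt Real.pi : ℂ)) *
      (z * ∫ u in (0 : ℝ)..1, Complex.exp (((u : ℂ) * z) ^ 2)))

lemma integrable_cexp_neg_sq_div_four_add (c : ℂ) :
    Integrable fun t : ℝ => cexp (-(t : ℂ) ^ 2 / 4 + c * t) := by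
  have h := integrable_cexp_quadratic' (b := -(1 / 4 : ℂ)) (by norm_num) c 0
  refine h.congr (ae_of_all _ fun t => ?_)
  simp only
  congr 1
  ring

lemma norm_cexp_neg_sq_div_four_add (c : ℂ) (t : ℝ) :
    ‖cexp (-(t : ℂ) ^ 2 / 4 + c * t)‖ = rexp (-t ^ 2 / 4 + c.re * t) := by
  rw [Complex.norm_exp]
  congr 1
  have : (-(t : ℂ) ^ 2 / 4 + c * t) = ((-t ^ 2 / 4 : ℝ) : ℂ) + c * t := by push_cast; ring
  rw [this, add_re, ofReal_re, re_mul_ofReal]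

lemma integrable_rexp_neg_sq_div_four_add (a : ℝ) :
    Integrable fun t : ℝ => rexp (-t ^ 2 / 4 + a * t) := by
  refine (integrable_cexp_neg_sq_div_four_add a).norm.congr (ae_of_all _ fun t => ?_)
  simp only [norm_cexp_neg_sq_div_four_add, ofReal_re]

lemma norm_mul_cexp_neg_sq_div_four_add_le {c : ℂ} {a t : ℝ} (hc : c.re ≤ a) (ht : 0 < t) :
    ‖(t : ℂ) * cexp (-(t : ℂ) ^ 2 / 4 + c * t)‖ ≤ rexp (-t ^ 2 / 4 + (a + 1) * t) := by
  rw [norm_mul, norm_cexp_neg_sq_div_four_add, norm_real, Real.norm_of_nonneg ht.le]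
  calc t * rexp (-t ^ 2 / 4 + c.re * t) ≤ rexp t * rexp (-t ^ 2 / 4 + a * t) := by
        gcongr
        linarith [Real.add_one_le_exp t]
    _ = rexp (-t ^ 2 / 4 + (a + 1) * t) := by
        rw [← Real.exp_add]
        congr 1
        ring

lemma integrableOn_mul_cexp_neg_sq_div_four_add (c : ℂ) :
    IntegrableOn (fun t : ℝ => (t : ℂ) * cexp (-(t : ℂ) ^ 2 / 4 + c * t)) (Set.Ioi 0) :=
  (integrable_rexp_neg_sq_div_four_add (c.re + 1)).integrableOn.mono'
    (by fun_prop) ((ae_restrict_iff' measurableSet_Ioi).2 (ae_of_all _ fun _ ht =>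
      norm_mul_cexp_neg_sq_div_four_add_le le_rfl ht))

lemma tendsto_cexp_neg_sq_div_four_add (c : ℂ) :
    Filter.Tendsto (fun t : ℝ => cexp (-(t : ℂ) ^ 2 / 4 + c * t)) Filter.atTop (nhds 0) := by
  have h := cexp_neg_quadratic_isLittleO_rpow_atTop (a := -(1 / 4 : ℂ)) (by norm_num) c 0
  simp only [Real.rpow_zero, Asymptotics.isLittleO_one_iff] at h
  refine h.congr fun t => ?_
  congr 1
  ring

lemma hasDerivAt_cexp_neg_sq_div_four_add (c : ℂ) (t : ℝ) :
    HasDerivAt (fun t : ℝ => cexp (-(t : ℂ) ^ 2 / 4 + c * t))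
      ((c - t / 2) * cexp (-(t : ℂ) ^ 2 / 4 + c * t)) t := by
  have h : HasDerivAt (fun s : ℂ => cexp (-s ^ 2 / 4 + c * s))
      (cexp (-(t : ℂ) ^ 2 / 4 + c * t) * (-(2 * (t : ℂ)) / 4 + c)) t := by
    have h1 : HasDerivAt (fun s : ℂ => -s ^ 2 / 4) (-(2 * (t : ℂ)) / 4) t := by
      simpa using ((hasDerivAt_pow 2 (t : ℂ)).fun_neg.div_const 4)
    have h2 : HasDerivAt (fun s : ℂ => c * s) c t := by
      simpa using (hasDerivAt_id (t : ℂ)).const_mul c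
    exact (h1.add h2).cexp
  exact h.comp_ofReal.congr_deriv (by ring)

lemma integral_Ioi_mul_cexp_neg_sq_div_four_add (c : ℂ) :
    ∫ t in Set.Ioi (0 : ℝ), (t : ℂ) * cexp (-(t : ℂ) ^ 2 / 4 + c * t) =
      2 * (c * (∫ t in Set.Ioi (0 : ℝ), cexp (-(t : ℂ) ^ 2 / 4 + c * t)) + 1) := by
  have hE := (integrable_cexp_neg_sq_div_four_add c).integrableOn (s := Set.Ioi 0)
  have htE := integrableOn_mul_cexp_neg_sq_div_four_add c
  have hsplit : (fun t : ℝ => (c - t / 2) * cexp (-(t : ℂ) ^ 2 / 4 + c * t)) =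
      fun t : ℝ => c * cexp (-(t : ℂ) ^ 2 / 4 + c * t) -
        2⁻¹ * ((t : ℂ) * cexp (-(t : ℂ) ^ 2 / 4 + c * t)) := by
    ext t
    ring
  have h := integral_Ioi_of_hasDerivAt_of_tendsto'
    (fun t _ => hasDerivAt_cexp_neg_sq_div_four_add c t)
    (by rw [hsplit]; exact (hE.const_mul c).sub (htE.const_mul 2⁻¹))
    (tendsto_cexp_neg_sq_div_four_add c)
  rw [hsplit, integral_sub (hE.const_mul c) (htE.const_mul 2⁻¹),
    MeasureTheory.integral_const_mul, MeasureTheory.integral_const_mul] at h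
  simp only [ofReal_zero, ne_eq, OfNat.ofNat_ne_zero, not_false_eq_true, zero_pow, neg_zero,
    zero_div, mul_zero, add_zero, Complex.exp_zero, zero_sub] at h
  linear_combination -2 * h

lemma hasDerivAt_integral_Ioi_cexp_neg_sq_div_four_add (c : ℂ) (u : ℝ) :
    HasDerivAt (fun u : ℝ => ∫ t in Set.Ioi (0 : ℝ), cexp (-(t : ℂ) ^ 2 / 4 + u * c * t))
      (∫ t in Set.Ioi (0 : ℝ), c * ((t : ℂ) * cexp (-(t : ℂ) ^ 2 / 4 + u * c * t))) u := by
  refine (_root_.hasDerivAt_integral_of_dominated_loc_of_deriv_le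
    (F := fun (u t : ℝ) => cexp (-(t : ℂ) ^ 2 / 4 + u * c * t))
    (F' := fun (u t : ℝ) => c * ((t : ℂ) * cexp (-(t : ℂ) ^ 2 / 4 + u * c * t)))
    (bound := fun t : ℝ => ‖c‖ * rexp (-t ^ 2 / 4 + ((|u| + 1) * ‖c‖ + 1) * t))
    (Metric.ball_mem_nhds u one_pos) ?_ ?_ ?_ ?_ ?_ ?_).2
  · exact .of_forall fun v => by fun_prop
  · exact (integrable_cexp_neg_sq_div_four_add _).integrableOn
  · fun_prop
  · refine (ae_restrict_iff' measurableSet_Ioi).2 (ae_of_all _ fun t ht v hv => ?_)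
    rw [norm_mul]
    gcongr
    refine norm_mul_cexp_neg_sq_div_four_add_le ?_ ht
    have hv' : |v| ≤ |u| + 1 := by
      rw [Metric.mem_ball, Real.dist_eq] at hv
      linarith [abs_sub_abs_le_abs_sub v u]
    calc ((v : ℂ) * c).re ≤ ‖(v : ℂ) * c‖ := re_le_norm _
      _ = |v| * ‖c‖ := by rw [norm_mul, norm_real, Real.norm_eq_abs]
      _ ≤ (|u| + 1) * ‖c‖ := by gcongr
  · exact ((integrable_rexp_neg_sq_div_four_add _).const_mul _).integrableOn
  · refine ae_of_all _ fun t v _ => ?_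
    have h : HasDerivAt (fun s : ℂ => -(t : ℂ) ^ 2 / 4 + s * c * t) (c * t) v := by
      simpa using (((hasDerivAt_id (v : ℂ)).mul_const c).mul_const (t : ℂ)).const_add
        (-(t : ℂ) ^ 2 / 4)
    exact h.cexp.comp_ofReal.congr_deriv (by ring)

lemma integral_Ioi_cexp_neg_sq_div_four :
    ∫ t in Set.Ioi (0 : ℝ), cexp (-(t : ℂ) ^ 2 / 4) = (√π : ℝ) := by
  have h (t : ℝ) : cexp (-(t : ℂ) ^ 2 / 4) = (rexp (-(1 / 4) * t ^ 2) : ℝ) := by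
    push_cast
    congr 1
    ring
  simp_rw [h]
  rw [integral_complex_ofReal, integral_gaussian_Ioi, div_div_eq_mul_div, div_one,
    Real.sqrt_mul pi_pos.le, show (4 : ℝ) = 2 ^ 2 by norm_num, Real.sqrt_sq zero_le_two]
  simp

/-- The differential equation satisfied along the ray `u ↦ u z` by the Laplace-type integral
turns it into the antiderivative of `exp ((u z)²)`. -/
lemma exp_sq_mul_integral_Ioi_cexp (z : ℂ) :
    cexp (z ^ 2) * ∫ t in Set.Ioi (0 : ℝ), cexp (-(t : ℂ) ^ 2 / 4 + I * z * t) =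
      (√π : ℝ) + 2 * I * z * ∫ u in (0 : ℝ)..1, cexp (((u : ℂ) * z) ^ 2) := by
  set F : ℝ → ℂ := fun u => ∫ t in Set.Ioi (0 : ℝ), cexp (-(t : ℂ) ^ 2 / 4 + u * (I * z) * t)
    with hF
  have hderiv (u : ℝ) : HasDerivAt (fun u : ℝ => cexp (((u : ℂ) * z) ^ 2) * F u)
      (2 * I * z * cexp (((u : ℂ) * z) ^ 2)) u := by
    have hF' := hasDerivAt_integral_Ioi_cexp_neg_sq_div_four_add (I * z) u
    rw [MeasureTheory.integral_const_mul, integral_Ioi_mul_cexp_neg_sq_div_four_add] at hF'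
    have hexp : HasDerivAt (fun s : ℂ => cexp ((s * z) ^ 2))
        (cexp (((u : ℂ) * z) ^ 2) * (2 * (u * z) * z)) u := by
      have h := ((hasDerivAt_id (u : ℂ)).mul_const z).fun_pow 2
      simpa using h.cexp
    refine (hexp.comp_ofReal.fun_mul hF').congr_deriv ?_
    linear_combination (2 * z ^ 2 * u * cexp (((u : ℂ) * z) ^ 2) * F u) * I_sq
  have h := integral_eq_sub_of_hasDerivAt (a := 0) (b := 1) (fun u _ => hderiv u)
    (Continuous.intervalIntegrable (by fun_prop) _ _)
  rw [intervalIntegral.integral_const_mul] at h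
  have hF0 : F 0 = (√π : ℝ) := by simp [hF, integral_Ioi_cexp_neg_sq_div_four]
  simp only [hF0, ofReal_one, ofReal_zero, one_mul, zero_mul, ne_eq, OfNat.ofNat_ne_zero,
    not_false_eq_true, zero_pow, Complex.exp_zero] at h
  simp only [hF, ofReal_one, one_mul] at h
  linear_combination -h

theorem faddeeva_eq_integral (x y : ℝ) (hy : 0 < y) :
    MeasureTheory.IntegrableOn
      (fun t : ℝ =>
        Complex.exp (-(t : ℂ) ^ 2 / 4) *
          Complex.exp (Complex.I * ((x : ℂ) + (y : ℂ) * Complex.I) * (t : ℂ)))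
      (Set.Ioi 0) ∧
    faddeeva ((x : ℂ) + (y : ℂ) * Complex.I) =
      (1 / (Real.sqrt Real.pi : ℂ)) *
        ∫ t in Set.Ioi (0 : ℝ),
          Complex.exp (-(t : ℂ) ^ 2 / 4) *
            Complex.exp (Complex.I * ((x : ℂ) + (y : ℂ) * Complex.I) * (t : ℂ)) := by
  set z : ℂ := x + y * I
  simp_rw [← Complex.exp_add]
  refine ⟨(integrable_cexp_neg_sq_div_four_add (I * z)).integrableOn, ?_⟩
  have hpi : ((√π : ℝ) : ℂ) ≠ 0 := ofReal_ne_zero.2 (Real.sqrt_ne_zero'.2 pi_pos)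
  have hexp : cexp (-z ^ 2) * cexp (z ^ 2) = 1 := by rw [← Complex.exp_add]; simp
  have h := exp_sq_mul_integral_Ioi_cexp z
  rw [faddeeva]
  generalize ∫ t in Set.Ioi (0 : ℝ), cexp (-(t : ℂ) ^ 2 / 4 + I * z * t) = J at h ⊢
  generalize ∫ u in (0 : ℝ)..1, cexp (((u : ℂ) * z) ^ 2) = K at h ⊢
  field_simp
  linear_combination J * hexp - cexp (-z ^ 2) * h
end

section
/- For all real numbers x and y with y > 0, the real part of w(x + iy) equals K(x, y) = (1/√π) · ∫_{0}^{∞} exp(−t²/4) · exp(−yt) · cos(xt) dt, where in particular this integral converges. -/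
open Real Complex MeasureTheory intervalIntegral

open Real Complex MeasureTheory intervalIntegral

/-- The integrand of the Laplace transform of the half-line Gaussian `t ↦ exp (-t² / 4)`. -/
noncomputable def gaussianExp (c : ℂ) (t : ℝ) : ℂ :=
  Complex.exp (-(1 / 4 : ℂ) * (t : ℂ) ^ 2 + c * t)

lemma continuous_gaussianExp (c : ℂ) : Continuous (gaussianExp c) := by
  unfold gaussianExp
  fun_prop

lemma integrable_gaussianExp (c : ℂ) : Integrable (gaussianExp c) := by
  have h := integrable_cexp_quadratic (b := 1 / 4) (by norm_num) c 0
  simpa only [add_zero] using! h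

lemma norm_gaussianExp (c : ℂ) (t : ℝ) :
    ‖gaussianExp c t‖ = Real.exp (-(1 / 4) * t ^ 2 + c.re * t) := by
  have h : (-(1 / 4 : ℂ) * (t : ℂ) ^ 2 + c * t) =
      ((-(1 / 4) * t ^ 2 : ℝ) : ℂ) + c * t := by push_cast; ring
  rw [gaussianExp, h, Complex.norm_exp, Complex.add_re, Complex.ofReal_re, Complex.re_mul_ofReal]

lemma norm_ofReal_mul_gaussianExp_le {c : ℂ} {r t : ℝ} (hc : c.re ≤ r) (ht : 0 ≤ t) :
    ‖(t : ℂ) * gaussianExp c t‖ ≤ ‖gaussianExp ((r + 1 : ℝ) : ℂ) t‖ := by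
  rw [norm_mul, norm_gaussianExp, norm_gaussianExp, Complex.norm_real, Real.norm_of_nonneg ht]
  calc t * Real.exp (-(1 / 4) * t ^ 2 + c.re * t)
      ≤ Real.exp t * Real.exp (-(1 / 4) * t ^ 2 + r * t) := by
        gcongr
        linarith [Real.add_one_le_exp t]
    _ = _ := by
        rw [← Real.exp_add, Complex.ofReal_re]
        ring_nf

lemma integrableOn_ofReal_mul_gaussianExp (c : ℂ) :
    IntegrableOn (fun t : ℝ => (t : ℂ) * gaussianExp c t) (Set.Ioi 0) := by
  refine Integrable.mono (integrable_gaussianExp ((c.re + 1 : ℝ) : ℂ)).integrableOn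
    (Complex.continuous_ofReal.mul (continuous_gaussianExp c)).aestronglyMeasurable ?_
  filter_upwards [ae_restrict_mem measurableSet_Ioi] with t ht
  exact norm_ofReal_mul_gaussianExp_le le_rfl (le_of_lt ht)

lemma tendsto_gaussianExp_atTop (c : ℂ) :
    Filter.Tendsto (gaussianExp c) Filter.atTop (nhds 0) := by
  have h := cexp_neg_quadratic_isLittleO_rpow_atTop (a := -(1 / 4)) (by norm_num) c 0
  simpa only [Real.rpow_zero, Asymptotics.isLittleO_one_iff] using! h

lemma integral_ofReal_mul_gaussianExp (c : ℂ) :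
    ∫ t in Set.Ioi (0 : ℝ), (t : ℂ) * gaussianExp c t =
      2 + 2 * c * ∫ t in Set.Ioi (0 : ℝ), gaussianExp c t := by
  have hd (t : ℝ) : HasDerivAt (gaussianExp c)
      (-(1 / 2) * ((t : ℂ) * gaussianExp c t) + c * gaussianExp c t) t := by
    have ht : HasDerivAt (fun s : ℝ => (s : ℂ)) 1 t := Complex.ofRealCLM.hasDerivAt
    have h := (((ht.pow 2).const_mul (-(1 / 4 : ℂ))).add (ht.const_mul c)).cexp
    refine h.congr_deriv ?_
    simp only [gaussianExp, Pi.add_apply, Pi.pow_apply]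
    push_cast
    ring
  have hi₁ := (integrableOn_ofReal_mul_gaussianExp c).const_mul (-(1 / 2 : ℂ))
  have hi₂ := (integrable_gaussianExp c).integrableOn (s := Set.Ioi 0) |>.const_mul c
  have h := integral_Ioi_of_hasDerivAt_of_tendsto' (a := 0) (fun t _ => hd t)
    (hi₁.add hi₂) (tendsto_gaussianExp_atTop c)
  rw [integral_add hi₁ hi₂, MeasureTheory.integral_const_mul,
    MeasureTheory.integral_const_mul] at h
  have h0 : gaussianExp c 0 = 1 := by simp [gaussianExp]
  rw [h0] at h
  linear_combination (-2) * h

lemma hasDerivAt_integral_gaussianExp (c : ℂ) :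
    HasDerivAt (fun c => ∫ t in Set.Ioi (0 : ℝ), gaussianExp c t)
      (2 + 2 * c * ∫ t in Set.Ioi (0 : ℝ), gaussianExp c t) c := by
  rw [← integral_ofReal_mul_gaussianExp]
  refine (hasDerivAt_integral_of_dominated_loc_of_deriv_le
    (F := gaussianExp) (F' := fun c t => (t : ℂ) * gaussianExp c t)
    (bound := fun t => ‖gaussianExp ((‖c‖ + 1 + 1 : ℝ) : ℂ) t‖)
    (Metric.ball_mem_nhds c one_pos)
    (.of_forall fun c => (continuous_gaussianExp c).aestronglyMeasurable)
    (integrable_gaussianExp c).integrableOn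
    (integrableOn_ofReal_mul_gaussianExp c).aestronglyMeasurable ?_
    (integrable_gaussianExp _).norm.integrableOn ?_).2
  · filter_upwards [ae_restrict_mem measurableSet_Ioi] with t ht w hw
    refine norm_ofReal_mul_gaussianExp_le ?_ (le_of_lt ht)
    have h₁ : ‖w - c‖ < 1 := by simpa [dist_eq_norm] using hw
    linarith [Complex.re_le_norm w, norm_le_norm_add_norm_sub' w c]
  · refine .of_forall fun t w _ => ?_
    have h := (((hasDerivAt_id w).mul_const (t : ℂ)).const_add
      (-(1 / 4 : ℂ) * (t : ℂ) ^ 2)).cexp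
    refine h.congr_deriv ?_
    simp only [gaussianExp, id]
    ring

lemma integral_gaussianExp_zero :
    ∫ t in Set.Ioi (0 : ℝ), gaussianExp 0 t = (Real.sqrt Real.pi : ℂ) := by
  have h (t : ℝ) : gaussianExp 0 t = ((Real.exp (-(1 / 4) * t ^ 2) : ℝ) : ℂ) := by
    simp [gaussianExp]
  simp_rw [h]
  rw [integral_complex_ofReal, integral_gaussian_Ioi, div_div_eq_mul_div, div_one,
    Real.sqrt_mul Real.pi_pos.le, show (4 : ℝ) = 2 ^ 2 by norm_num, Real.sqrt_sq two_pos.le]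
  push_cast
  ring

lemma exp_sq_mul_integral_gaussianExp (z : ℂ) :
    Complex.exp (z ^ 2) * ∫ t in Set.Ioi (0 : ℝ), gaussianExp (I * z) t =
      (Real.sqrt Real.pi : ℂ) +
        2 * I * (z * ∫ u in (0 : ℝ)..1, Complex.exp (((u : ℂ) * z) ^ 2)) := by
  have hd (u : ℝ) : HasDerivAt (fun u : ℝ => Complex.exp (((u : ℂ) * z) ^ 2) *
      ∫ t in Set.Ioi (0 : ℝ), gaussianExp (I * (u * z)) t)
      (2 * I * z * Complex.exp (((u : ℂ) * z) ^ 2)) u := by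
    have hu : HasDerivAt (fun s : ℝ => (s : ℂ) * z) (1 * z) u :=
      HasDerivAt.mul_const (Complex.ofRealCLM.hasDerivAt (x := u)) z
    have h := (hu.pow 2).cexp.mul
      ((hasDerivAt_integral_gaussianExp (I * (u * z))).comp u (hu.const_mul I))
    refine h.congr_deriv ?_
    simp only [Function.comp_apply, Pi.pow_apply]
    push_cast
    linear_combination (2 * u * z ^ 2 * Complex.exp (((u : ℂ) * z) ^ 2) *
      ∫ t in Set.Ioi (0 : ℝ), gaussianExp (I * (u * z)) t) * Complex.I_sq
  have h := integral_eq_sub_of_hasDerivAt (a := 0) (b := 1) (fun u _ => hd u)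
    (Continuous.intervalIntegrable (by fun_prop) _ _)
  rw [intervalIntegral.integral_const_mul] at h
  simp only [Complex.ofReal_one, one_mul, Complex.ofReal_zero, zero_mul, mul_zero,
    integral_gaussianExp_zero, ne_eq, OfNat.ofNat_ne_zero, not_false_eq_true, zero_pow,
    Complex.exp_zero] at h
  linear_combination -h

/-- The Faddeeva function as a half-line Fourier–Laplace transform of a Gaussian. -/
lemma faddeeva_eq_integral_gaussianExp (z : ℂ) :
    faddeeva z =
      (1 / Real.sqrt Real.pi : ℝ) * ∫ t in Set.Ioi (0 : ℝ), gaussianExp (I * z) t := by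
  have hpi : (Real.sqrt Real.pi : ℂ) ≠ 0 :=
    Complex.ofReal_ne_zero.mpr (Real.sqrt_pos.mpr Real.pi_pos).ne'
  have h := exp_sq_mul_integral_gaussianExp z
  have he : Complex.exp (-z ^ 2) * Complex.exp (z ^ 2) = 1 := by
    rw [← Complex.exp_add, neg_add_cancel, Complex.exp_zero]
  rw [faddeeva]
  generalize (∫ t in Set.Ioi (0 : ℝ), gaussianExp (I * z) t) = L at h ⊢
  generalize (∫ u in (0 : ℝ)..1, Complex.exp (((u : ℂ) * z) ^ 2)) = J at h ⊢
  push_cast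
  field_simp
  linear_combination (-Complex.exp (-z ^ 2)) * h + L * he

lemma re_gaussianExp (x y t : ℝ) :
    (gaussianExp (I * (x + y * I)) t).re =
      Real.exp (-t ^ 2 / 4) * Real.exp (-y * t) * Real.cos (x * t) := by
  have h : -(1 / 4 : ℂ) * (t : ℂ) ^ 2 + I * (x + y * I) * t =
      ((-t ^ 2 / 4 + -y * t : ℝ) : ℂ) + ((x * t : ℝ) : ℂ) * I := by
    push_cast
    linear_combination (y * t : ℂ) * Complex.I_sq
  rw [gaussianExp, h, Complex.exp_re, ← Real.exp_add]
  simp only [Complex.add_re, Complex.add_im, Complex.ofReal_re, Complex.ofReal_im,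
    Complex.re_ofReal_mul, Complex.im_ofReal_mul, Complex.I_re, Complex.I_im, mul_zero, mul_one,
    add_zero, zero_add]

theorem re_faddeeva_eq_voigt (x y : ℝ) (hy : 0 < y) :
    MeasureTheory.IntegrableOn
      (fun t : ℝ => Real.exp (-t ^ 2 / 4) * Real.exp (-y * t) * Real.cos (x * t))
      (Set.Ioi 0) ∧
    (faddeeva ((x : ℂ) + (y : ℂ) * Complex.I)).re =
      (1 / Real.sqrt Real.pi) *
        ∫ t in Set.Ioi (0 : ℝ),
          Real.exp (-t ^ 2 / 4) * Real.exp (-y * t) * Real.cos (x * t) := by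
  have hi : IntegrableOn (gaussianExp (I * (x + y * I))) (Set.Ioi 0) :=
    (integrable_gaussianExp _).integrableOn
  simp_rw [← re_gaussianExp]
  refine ⟨hi.re, ?_⟩
  rw [faddeeva_eq_integral_gaussianExp, Complex.re_ofReal_mul]
  exact congrArg _ (integral_re hi).symm
end
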